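/- The vector π_a(x) − π_b(x) satisfies ⟨F(x), π_a(x) − π_b(x)⟩ ≤ 0 for every x ∈ ℝⁿ (i.e., π_a(x) − π_b(x) lies in the polar cone of the ray generated by F(x)). -/

import Mathlib

open RealInnerProductSpace

/-- `⟨F x, π_a x − π_b x⟩ ≤ 0` for every `x`. -/
theorem dgap_stmt9 {n : ℕ} (K : Set (EuclideanSpace ℝ (Fin n)))
    (hK : K.Nonempty) (hKc : IsClosed K) (hKconv : Convex ℝ K)
    (F : EuclideanSpace ℝ (Fin n) → EuclideanSpace ℝ (Fin n)) (hF : Continuous F)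
    (a b : ℝ) (ha : 0 < a) (hab : a < b)
    (P : EuclideanSpace ℝ (Fin n) → EuclideanSpace ℝ (Fin n))
    (hP : ∀ z, P z ∈ K ∧ ∀ y ∈ K, ⟪z - P z, y - P z⟫ ≤ 0) :
    ∀ x, ⟪F x, P (x - a⁻¹ • F x) - P (x - b⁻¹ • F x)⟫ ≤ 0 := by
  intro x
  have h1 := (hP (x - a⁻¹ • F x)).2 _ (hP (x - b⁻¹ • F x)).1
  have h2 := (hP (x - b⁻¹ • F x)).2 _ (hP (x - a⁻¹ • F x)).1
  have hst : b⁻¹ < a⁻¹ := inv_strictAnti₀ ha hab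
  generalize P (x - a⁻¹ • F x) = p at *
  generalize P (x - b⁻¹ • F x) = q at *
  have h3 : 0 ≤ inner ℝ (p - q) (p - q) := real_inner_self_nonneg
  have h4 : (a⁻¹ - b⁻¹) * inner ℝ (F x) (p - q) + inner ℝ (p - q) (p - q)
      = inner ℝ (x - a⁻¹ • F x - p) (q - p) + inner ℝ (x - b⁻¹ • F x - q) (p - q) := by
    simp only [inner_sub_left, inner_sub_right, real_inner_smul_left]
    ring
  by_contra! hc
  have := mul_pos (sub_pos.2 hst) hc
  linarith
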